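/- Let m be a multisegment and [a,b] a segment with D^Lang_{[a,b]}(m) ≠ ∞, and suppose D_{[a]}(m) = m − Δ_a + ⁻Δ_a for some Δ_a ∈ m[a] with Δ_a ∉ m_{[a,b]}. Then, performing the removal steps of the tds(·,a)-process on m and on D^Lang_{[a,b]}(m) respectively until termination, the resulting two multisets of remaining segments that start at a and do not lie in m_{[a,b]} are equal. -/

import Mathlib

namespace Multiseg

/-- A segment `[a,b]` on a fixed cuspidal line, encoded by its endpoints. -/
abbrev Seg := ℤ × ℤ

/-- A multiset of pairs is a multisegment when each pair is a genuine segment. -/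
def IsMS (m : Multiset Seg) : Prop := ∀ Δ ∈ m, Δ.1 ≤ Δ.2

/-- `Δ ≺ Δ'` : the segment `Δ` precedes `Δ'`. -/
def Prec (Δ Δ' : Seg) : Prop := Δ.1 < Δ'.1 ∧ Δ.2 < Δ'.2 ∧ Δ'.1 ≤ Δ.2 + 1

instance : DecidableRel Prec := fun _ _ => by unfold Prec; infer_instance

/-- `Δ ⊆ Δ'` as segments. -/
def SSub (Δ Δ' : Seg) : Prop := Δ'.1 ≤ Δ.1 ∧ Δ.2 ≤ Δ'.2

/-- `m[i]`, the segments of `m` starting at `i`. -/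
def startAt (m : Multiset Seg) (i : ℤ) : Multiset Seg := m.filter fun Δ => Δ.1 = i

/-- `m⟨i⟩`, the segments of `m` ending at `i`. -/
def endAt (m : Multiset Seg) (i : ℤ) : Multiset Seg := m.filter fun Δ => Δ.2 = i

/-- `m_{[a,b]} = {[a',b'] ∈ m : a ≤ a' ≤ b+1 ≤ b'+1}`. -/
def mRange (m : Multiset Seg) (a b : ℤ) : Multiset Seg :=
  m.filter fun Δ => a ≤ Δ.1 ∧ Δ.1 ≤ b + 1 ∧ b ≤ Δ.2

/-- Add the segment `[x,y]` to `m`, discarding it if it is void. -/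
def pushSeg (m : Multiset Seg) (x y : ℤ) : Multiset Seg :=
  if x ≤ y then m + {(x, y)} else m

def msetMax (s : Multiset ℤ) : Option ℤ :=
  if h : s = 0 then none else some (s.toFinset.max' (Multiset.toFinset_nonempty.mpr h))

def msetMin (s : Multiset ℤ) : Option ℤ :=
  if h : s = 0 then none else some (s.toFinset.min' (Multiset.toFinset_nonempty.mpr h))

/-- The longest segment of `m[i]`, if any. -/
def longStart (m : Multiset Seg) (i : ℤ) : Option Seg :=
  (msetMax ((startAt m i).map Prod.snd)).map fun y => (i, y)

/-- The shortest segment of `m[i]`, if any. -/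
def shortStart (m : Multiset Seg) (i : ℤ) : Option Seg :=
  (msetMin ((startAt m i).map Prod.snd)).map fun y => (i, y)

/-- The longest segment of `m⟨i⟩`, if any. -/
def longEnd (m : Multiset Seg) (i : ℤ) : Option Seg :=
  (msetMin ((endAt m i).map Prod.fst)).map fun x => (x, i)

/-- The shortest segment of `m⟨i⟩`, if any. -/
def shortEnd (m : Multiset Seg) (i : ℤ) : Option Seg :=
  (msetMax ((endAt m i).map Prod.fst)).map fun x => (x, i)

/-- One removal step of the `tds(·,c)` process: remove the longest segment `Δ''`
of `m[c+1]` and the longest segment `Δ'` of `m[c]` with `Δ' ≺ Δ''`. -/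
def tdsStep (m : Multiset Seg) (c : ℤ) : Option (Multiset Seg) :=
  match longStart m (c + 1) with
  | none => none
  | some Δ'' =>
    match msetMax (((startAt m c).filter fun Δ => Prec Δ Δ'').map Prod.snd) with
    | none => none
    | some y => some ((m.erase (c, y)).erase Δ'')

def tdsIterF (c : ℤ) : ℕ → Multiset Seg → Multiset Seg
  | 0, m => m
  | n + 1, m =>
    match tdsStep m c with
    | none => m
    | some m' => tdsIterF c n m'

/-- Iterate the `tds(·,c)` process until it terminates. -/
def tdsIter (c : ℤ) (m : Multiset Seg) : Multiset Seg := tdsIterF c m.card m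

/-- The `ρ`-derivative algorithm `𝒟_{[a]}`; the value `none` codes `∞`. -/
def Drho (a : ℤ) (m : Multiset Seg) : Option (Multiset Seg) :=
  (shortStart (tdsIter a m) a).map fun Δ => pushSeg (m.erase Δ) (a + 1) Δ.2

/-- `ε_{[a]}(m)`, the number of segments starting at `a` left after the
`tds(·,a)` process terminates. -/
def epsA (a : ℤ) (m : Multiset Seg) : ℕ := (startAt (tdsIter a m) a).card

/-- The next element of an upward sequence after `p`. -/
def usNext (n : Multiset Seg) (p : Seg) : Option Seg :=
  match msetMin ((n.filter fun Δ => Prec p Δ).map Prod.fst) with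
  | none => none
  | some aj =>
    (msetMax ((((n.filter fun Δ => Prec p Δ).filter fun Δ => Δ.1 = aj)).map Prod.snd)).map
      fun y => (aj, y)

def usAux (n : Multiset Seg) : ℕ → Seg → List Seg
  | 0, _ => []
  | fuel + 1, p =>
    match usNext n p with
    | none => []
    | some Δ => Δ :: usAux n fuel Δ

/-- The upward sequence `Us(n)` of maximally linked segments of `n`. -/
def usList (n : Multiset Seg) : List Seg :=
  match msetMin (n.map Prod.fst) with
  | none => []
  | some a1 =>
    match longStart n a1 with
    | none => []
    | some Δ1 => Δ1 :: usAux n n.card Δ1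

/-- The decomposition of a multisegment into successive upward sequences. -/
def usDecomp : ℕ → Multiset Seg → List (List Seg)
  | 0, _ => []
  | fuel + 1, n =>
    if n = 0 then [] else usList n :: usDecomp fuel (n - (usList n : Multiset Seg))

/-- `[x,y] ⊆ [u,v]` (with the void interval contained in anything). -/
def intSubB (x y u v : ℤ) : Bool := decide (y < x) || (decide (u ≤ x) && decide (y ≤ v))

/-- Find, in a row of an upward-sequence decomposition, the first segment `Δ`
whose removable free section contains `[s(Δ), top]`. -/
def findRowD : List Seg → ℤ → Option Seg
  | [], _ => none
  | [Δ], top => if intSubB Δ.1 top Δ.1 Δ.2 then some Δ else none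
  | Δ :: Δ' :: rest, top =>
    if intSubB Δ.1 top Δ.1 (Δ'.1 - 2) then some Δ else findRowD (Δ' :: rest) top

/-- The selection step of the Langlands derivative algorithm, scanning the rows
downwards from the last one; it records each selected segment together with the
start of its truncation. -/
def selAuxD (rows : List (List Seg)) : ℕ → ℤ → List (Seg × ℤ)
  | 0, _ => []
  | n + 1, top =>
    match findRowD (rows.getD n []) top with
    | some Δ => (Δ, top + 1) :: selAuxD rows n (Δ.1 - 1)
    | none => selAuxD rows n top

/-- The Langlands derivative algorithm `𝒟^Lang_{[a,b]}`; `none` codes `∞`. -/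
def DLang (a b : ℤ) (m : Multiset Seg) : Option (Multiset Seg) :=
  let m1 := mRange m a b
  let rows := usDecomp m1.card m1
  let sel := selAuxD rows rows.length b
  match sel.getLast? with
  | none => none
  | some (Δl, _) =>
    if Δl.1 = a then
      some (sel.foldl (fun acc p => pushSeg (acc.erase p.1) p.2 p.1.2) m)
    else none

/-- One removal step of the `tus(·,c)` process. -/
def tusStep (n : Multiset Seg) (c : ℤ) : Option (Multiset Seg) :=
  match shortStart n c with
  | none => none
  | some Δ' =>
    match msetMin (((startAt n (c + 1)).filter fun Δ => Prec Δ' Δ).map Prod.snd) with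
    | none => none
    | some y => some ((n.erase Δ').erase (c + 1, y))

def tusIterF (c : ℤ) : ℕ → Multiset Seg → Multiset Seg
  | 0, n => n
  | k + 1, n =>
    match tusStep n c with
    | none => n
    | some n' => tusIterF c k n'

/-- Iterate the `tus(·,c)` process until it terminates. -/
def tusIter (c : ℤ) (n : Multiset Seg) : Multiset Seg := tusIterF c n.card n

/-- The `ρ`-integral algorithm `ℐ_{[a]}` (always defined). -/
def Irho (a : ℤ) (n : Multiset Seg) : Multiset Seg :=
  match longStart (tusIter a n) (a + 1) with
  | none => n + {(a, a)}
  | some Δ => pushSeg (n.erase Δ) a Δ.2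

/-- The next element of a downward sequence after `p`. -/
def dsNext (n : Multiset Seg) (p : Seg) : Option Seg :=
  match msetMax ((n.filter fun Δ => Prec Δ p).map Prod.fst) with
  | none => none
  | some aq => shortStart n aq

def dsAux (n : Multiset Seg) : ℕ → Seg → List Seg
  | 0, _ => []
  | k + 1, p =>
    match dsNext n p with
    | none => []
    | some Δ => Δ :: dsAux n k Δ

/-- The downward sequence `Ds(n)` of minimal linked segments with the largest
starting. -/
def dsList (n : Multiset Seg) : List Seg :=
  match msetMax (n.map Prod.fst) with
  | none => []
  | some a1 =>
    match shortStart n a1 with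
    | none => []
    | some Δ1 => Δ1 :: dsAux n n.card Δ1

/-- The decomposition of a multisegment into successive downward sequences. -/
def dsDecomp : ℕ → Multiset Seg → List (List Seg)
  | 0, _ => []
  | k + 1, n =>
    if n = 0 then [] else dsList n :: dsDecomp k (n - (dsList n : Multiset Seg))

/-- Find, in a row of a downward-sequence decomposition, the segment whose set
of addable free points contains `pt`. -/
def findRowI (a : ℤ) : List Seg → ℤ → Option Seg
  | [], _ => none
  | [Δ], pt => if decide (a ≤ pt) && decide (pt ≤ Δ.1 - 1) then some Δ else none
  | Δ :: Δ' :: rest, pt =>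
    if decide (Δ'.1 + 1 ≤ pt) && decide (pt ≤ Δ.1 - 1) then some Δ
    else findRowI a (Δ' :: rest) pt

/-- The selection step of the Langlands integral algorithm; it records each
selected segment together with the start of its extension. -/
def selAuxI (a : ℤ) (rows : List (List Seg)) : ℕ → ℤ → List (Seg × ℤ)
  | 0, _ => []
  | n + 1, pt =>
    match findRowI a (rows.getD n []) pt with
    | some Δ => (Δ, pt) :: selAuxI a rows n Δ.1
    | none => selAuxI a rows n pt

/-- The Langlands integral algorithm `ℐ^Lang_{[a,b]}`. -/
def ILang (a b : ℤ) (m : Multiset Seg) : Multiset Seg :=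
  let m1 := mRange m a b
  let rows := dsDecomp m1.card m1
  let sel := selAuxI a rows rows.length a
  let base := sel.foldl (fun acc p => pushSeg (acc.erase p.1) p.2 p.1.2) m
  match sel.getLast? with
  | none => pushSeg base a b
  | some (Δl, _) => pushSeg base Δl.1 b

/-- `m` is in good range for `[a,b]`. -/
def GoodRange (m : Multiset Seg) (a b : ℤ) : Prop := mRange m a b = m

/-- `Θ`, the Gelfand–Kazhdan involution on multisegments. -/
def Theta (m : Multiset Seg) : Multiset Seg := m.map fun Δ => (-Δ.2, -Δ.1)

/-- The exotic duality `𝔻_r`. -/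
def Dual (r : ℤ) (m : Multiset Seg) : Multiset Seg :=
  m.map fun Δ => (-r + Δ.2 + 1, Δ.1 - 1)

/-- `𝔻_r^{[a,b]}`. -/
def DualAB (r a b : ℤ) (m : Multiset Seg) : Multiset Seg := Dual r m + {(b - r + 1, b)}

/-- The left Langlands derivative algorithm `𝒟^{Lang,L}_{[a,b]}`. -/
def DLangL (a b : ℤ) (m : Multiset Seg) : Option (Multiset Seg) :=
  (DLang (-b) (-a) (Theta m)).map Theta

/-- The left `ρ`-derivative algorithm `𝒟^{Lang,L}_{[a]}`. -/
def DrhoL (a : ℤ) (m : Multiset Seg) : Option (Multiset Seg) :=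
  (Drho (-a) (Theta m)).map Theta

/-- The next segment chosen by the MW algorithm after `p`. -/
def mwNext (m : Multiset Seg) (p : Seg) : Option Seg :=
  (msetMax (((endAt m (p.2 - 1)).filter fun Δ => Prec Δ p).map Prod.fst)).map
    fun x => (x, p.2 - 1)

def mwAux (m : Multiset Seg) : ℕ → Seg → List Seg
  | 0, _ => []
  | k + 1, p =>
    match mwNext m p with
    | none => []
    | some Δ => Δ :: mwAux m k Δ

/-- The ordered segments participating in the MW algorithm for `m`. -/
def mwList (m : Multiset Seg) : List Seg :=
  match msetMax (m.map Prod.snd) with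
  | none => []
  | some b0 =>
    match shortEnd m b0 with
    | none => []
    | some Δ0 => Δ0 :: mwAux m m.card Δ0

/-- `𝒟^MW(m)`. -/
def DMW (m : Multiset Seg) : Multiset Seg :=
  (mwList m).foldl (fun acc Δ => pushSeg (acc.erase Δ) Δ.1 (Δ.2 - 1)) m

/-- The first segment `Δ(m)` produced by the MW algorithm for `m`. -/
def mwFirstSeg (m : Multiset Seg) : Option Seg :=
  match (mwList m).head?, (mwList m).getLast? with
  | some Δ0, some Δk => some (Δk.1, Δ0.2)
  | _, _ => none

/-- The total relative length of a multisegment. -/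
def totalLen (m : Multiset Seg) : ℕ := (m.map fun Δ => (Δ.2 - Δ.1 + 1).toNat).sum

def sharpAux : ℕ → Multiset Seg → Multiset Seg
  | 0, _ => 0
  | k + 1, m =>
    if m = 0 then 0
    else
      match mwFirstSeg m with
      | none => 0
      | some Δ => Δ ::ₘ sharpAux k (DMW m)

/-- The Mœglin–Waldspurger involution `m^#`. -/
def msharp (m : Multiset Seg) : Multiset Seg := sharpAux (totalLen m) m

/-- `ε^MW_{[a,c]}(m)`, the multiplicity of `[a,c]` in `m^#`. -/
def epsMW (a c : ℤ) (m : Multiset Seg) : ℕ := (msharp m).count (a, c)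

/-- `m_i`: remove from `m` the participants of the first `i` runs of the MW
algorithm. -/
def mwStage (m : Multiset Seg) : ℕ → Multiset Seg
  | 0 => m
  | i + 1 => mwStage m i - (mwList (DMW^[i] m) : Multiset Seg)

/-- `MW_k(m)`: all segments ending at `k` participating in the first `r` runs
of the MW algorithm. -/
def MWkSet (m : Multiset Seg) (r : ℕ) (k : ℤ) : Multiset Seg :=
  ∑ i ∈ Finset.range r, (mwList (DMW^[i] m) : Multiset Seg).filter fun Δ => Δ.2 = k

def upNbrAux (m : Multiset Seg) : ℕ → Seg → Option (List Seg)
  | 0, p => some [p]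
  | k + 1, p =>
    match msetMin (((endAt m (p.2 + 1)).filter fun Δ => Prec p Δ).map Prod.fst) with
    | none => none
    | some x => (upNbrAux m k (x, p.2 + 1)).map fun l => p :: l

/-- The removal upward sequence of maximal linked segments in neighbors on `m`
ranging from `a-1` to `b` (if it exists). -/
def upSeqNbr (m : Multiset Seg) (a b : ℤ) : Option (List Seg) :=
  match longEnd m (a - 1) with
  | none => none
  | some Δ => upNbrAux m (b - (a - 1)).toNat Δ

def zelRemF (a b : ℤ) : ℕ → Multiset Seg → Multiset Seg
  | 0, m => m
  | k + 1, m =>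
    match upSeqNbr m a b with
    | none => m
    | some l => zelRemF a b k (m - (l : Multiset Seg))

/-- Repeatedly remove removal upward sequences of maximal linked segments in
neighbors ranging from `a-1` to `b`, until none exists. -/
def zelRem (a b : ℤ) (m : Multiset Seg) : Multiset Seg := zelRemF a b m.card m

def zelRemCountF (a b : ℤ) : ℕ → Multiset Seg → ℕ
  | 0, _ => 0
  | k + 1, m =>
    match upSeqNbr m a b with
    | none => 0
    | some l => zelRemCountF a b k (m - (l : Multiset Seg)) + 1

/-- The number of removal upward sequences of maximal linked segments in
neighbors ranging from `a-1` to `b` successively removed from `m`. -/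
def zelRemCount (a b : ℤ) (m : Multiset Seg) : ℕ := zelRemCountF a b m.card m

def downNbrAux (m : Multiset Seg) : ℕ → Seg → Option (List Seg)
  | 0, p => some [p]
  | k + 1, p =>
    match msetMax (((endAt m (p.2 - 1)).filter fun Δ => Prec Δ p).map Prod.fst) with
    | none => none
    | some x => (downNbrAux m k (x, p.2 - 1)).map fun l => p :: l

/-- The Zelevinsky derivative algorithm `𝒟^Zel_{[a,b]}`; `none` codes `∞`. -/
def DZel (a b : ℤ) (m : Multiset Seg) : Option (Multiset Seg) :=
  match shortEnd (zelRem a b m) b with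
  | none => none
  | some Δb =>
    match downNbrAux (zelRem a b m) (b - a).toNat Δb with
    | none => none
    | some l => some (l.foldl (fun acc Δ => pushSeg (acc.erase Δ) Δ.1 (Δ.2 - 1)) m)

/-- The downward sequence of minimal linked segments in neighbors on `m`
ranging from `b` to `a-1` (if it exists). -/
def downSeqNbr (m : Multiset Seg) (a b : ℤ) : Option (List Seg) :=
  match shortEnd m b with
  | none => none
  | some Δ => downNbrAux m (b - (a - 1)).toNat Δ

def izRemF (a b : ℤ) : ℕ → Multiset Seg → Multiset Seg
  | 0, m => m
  | k + 1, m =>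
    match downSeqNbr m a b with
    | none => m
    | some l => izRemF a b k (m - (l : Multiset Seg))

/-- Repeatedly remove downward sequences of minimal linked segments in
neighbors ranging from `b` to `a-1`, until none exists. -/
def izRem (a b : ℤ) (m : Multiset Seg) : Multiset Seg := izRemF a b m.card m

def extNext (m : Multiset Seg) (p : Seg) : Option Seg :=
  (msetMin (((endAt m (p.2 + 1)).filter fun Δ => Prec p Δ).map Prod.fst)).map
    fun x => (x, p.2 + 1)

def extAux (m : Multiset Seg) : ℕ → Option Seg → List (Option Seg)
  | 0, _ => []
  | k + 1, p =>
    let cur := p.bind (extNext m)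
    cur :: extAux m k cur

/-- The (possibly void) segments `Δ̃_{a-1}, …, Δ̃_{b-1}` participating in the
extension process of the Zelevinsky integral algorithm on `m`. -/
def extList (m : Multiset Seg) (a b : ℤ) : List (Option Seg) :=
  longEnd m (a - 1) :: extAux m (b - a).toNat (longEnd m (a - 1))

def applyExt : Multiset Seg → ℤ → List (Option Seg) → Multiset Seg
  | acc, _, [] => acc
  | acc, i, some Δ :: rest => applyExt (pushSeg (acc.erase Δ) Δ.1 (Δ.2 + 1)) (i + 1) rest
  | acc, i, none :: rest => applyExt (acc + {(i + 1, i + 1)}) (i + 1) rest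

/-- The Zelevinsky integral algorithm `ℐ^Zel_{[a,b]}`. -/
def IZel (a b : ℤ) (m : Multiset Seg) : Multiset Seg :=
  applyExt m (a - 1) (extList (izRem a b m) a b)

/-- `Δ̃⁺` for a possibly void `Δ̃` at position `i` (for the void segment at
position `i` this is the singleton `[i+1,i+1]`). -/
def plusAt (i : ℤ) : Option Seg → Seg
  | some Δ => (Δ.1, Δ.2 + 1)
  | none => (i + 1, i + 1)

def plusList : ℤ → List (Option Seg) → List Seg
  | _, [] => []
  | i, o :: rest => plusAt i o :: plusList (i + 1) rest

/-- `n₁` and `n₂` are linked by mapping: there is an injective map `f : n₁ → n₂`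
with `Δ ≺ f(Δ)` for all `Δ ∈ n₁`. -/
def LinkedByMapping (n₁ n₂ : Multiset Seg) : Prop :=
  ∃ n₂' ≤ n₂, Multiset.Rel Prec n₁ n₂'

def startsSorted (n : Multiset Seg) : List ℤ := (n.map Prod.fst).sort (· ≤ ·)

/-- `n₁' < n₁` for multisegments of segments ending at a common point, compared
via their sorted lists of starting points. -/
def MSLtStarts (n₁' n₁ : Multiset Seg) : Prop :=
  startsSorted n₁' ≠ startsSorted n₁ ∧
    List.Forall₂ (· ≤ ·) (startsSorted n₁) (startsSorted n₁')

/-- `n₁ ⊆ m⟨k-1⟩` and `n₂ ⊆ m⟨k⟩` are minimally linked in `m`. -/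
def MinLinked (m : Multiset Seg) (k : ℤ) (n₁ n₂ : Multiset Seg) : Prop :=
  n₁ ≤ endAt m (k - 1) ∧ n₂ ≤ endAt m k ∧ LinkedByMapping n₁ n₂ ∧
    (∀ n₁' ≤ endAt m (k - 1), LinkedByMapping n₁' n₂ → n₁'.card ≤ n₁.card) ∧
    (∀ n₁' ≤ endAt m (k - 1), n₁'.card = n₁.card → MSLtStarts n₁' n₁ →
      ¬LinkedByMapping n₁' n₂)

/-- The non-free sections of a row of an upward-sequence decomposition. -/
def nfRow : List Seg → Multiset Seg
  | [] => 0
  | [_] => 0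
  | Δ :: Δ' :: rest => pushSeg (nfRow (Δ' :: rest)) (Δ'.1 - 1) Δ.2

/-- `𝔡(m)`, the sum of all non-free sections. -/
def frakd (m : Multiset Seg) : Multiset Seg :=
  (usDecomp m.card m).foldl (fun acc row => acc + nfRow row) 0

def DrhoPow (t : ℤ) : ℕ → Multiset Seg → Option (Multiset Seg)
  | 0, m => some m
  | k + 1, m => (Drho t m).bind (DrhoPow t k)

/-- `(𝒟_{[a+n-1]})^{ε_{a+n-1}} ∘ ⋯ ∘ (𝒟_{[a]})^{ε_a}(m)` where at each stage `t`
the exponent is `ε_t = ε_{[t]}` of the current multisegment; `none` codes that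
some derivative in the composition is `∞`. -/
def hdComp : ℕ → ℤ → Multiset Seg → Option (Multiset Seg)
  | 0, _, m => some m
  | k + 1, t, m =>
    match DrhoPow t (epsA t m) m with
    | none => none
    | some m' => hdComp k (t + 1) m'



theorem msetMax_some {s : Multiset ℤ} {y : ℤ} (h : msetMax s = some y) :
    y ∈ s ∧ ∀ z ∈ s, z ≤ y := by
  unfold msetMax at h
  split_ifs at h with h0
  simp only [Option.some.injEq] at h
  subst h
  refine ⟨by simpa using Finset.max'_mem s.toFinset (Multiset.toFinset_nonempty.mpr h0), ?_⟩
  intro z hz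
  exact Finset.le_max' _ _ (by simpa using hz)

theorem msetMax_none {s : Multiset ℤ} (h : msetMax s = none) : s = 0 := by
  unfold msetMax at h
  split_ifs at h with h0
  exact h0

theorem msetMin_some {s : Multiset ℤ} {y : ℤ} (h : msetMin s = some y) :
    y ∈ s ∧ ∀ z ∈ s, y ≤ z := by
  unfold msetMin at h
  split_ifs at h with h0
  simp only [Option.some.injEq] at h
  subst h
  refine ⟨by simpa using Finset.min'_mem s.toFinset (Multiset.toFinset_nonempty.mpr h0), ?_⟩
  intro z hz
  exact Finset.min'_le _ _ (by simpa using hz)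

theorem msetMin_none {s : Multiset ℤ} (h : msetMin s = none) : s = 0 := by
  unfold msetMin at h
  split_ifs at h with h0
  exact h0

/-- Sum of a weight over a multisegment. -/
def wsum (φ : Seg → ℤ) (M : Multiset Seg) : ℤ := (M.map φ).sum

theorem wsum_add (φ : Seg → ℤ) (M N : Multiset Seg) : wsum φ (M + N) = wsum φ M + wsum φ N := by
  simp [wsum]

theorem wsum_zero (φ : Seg → ℤ) : wsum φ 0 = 0 := by simp [wsum]

theorem wsum_single (φ : Seg → ℤ) (Δ : Seg) : wsum φ {Δ} = φ Δ := by simp [wsum]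

theorem wsum_cons (φ : Seg → ℤ) (Δ : Seg) (l : List Seg) :
    wsum φ ((Δ :: l : List Seg) : Multiset Seg) = φ Δ + wsum φ (l : Multiset Seg) := by
  simp [wsum]

theorem wsum_erase (φ : Seg → ℤ) {Δ : Seg} {M : Multiset Seg} (h : Δ ∈ M) :
    wsum φ (M.erase Δ) = wsum φ M - φ Δ := by
  have := congrArg (wsum φ) (Multiset.cons_erase h)
  rw [← Multiset.singleton_add, wsum_add, wsum_single] at this
  linarith

theorem wsum_congr {φ ψ : Seg → ℤ} {M : Multiset Seg} (h : ∀ Δ ∈ M, φ Δ = ψ Δ) :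
    wsum φ M = wsum ψ M := by
  unfold wsum; rw [Multiset.map_congr rfl h]

theorem wsum_le {φ ψ : Seg → ℤ} {M : Multiset Seg} (h : ∀ Δ ∈ M, φ Δ ≤ ψ Δ) :
    wsum φ M ≤ wsum ψ M := Multiset.sum_map_le_sum_map _ _ h

theorem wsum_eq_zero {φ : Seg → ℤ} {M : Multiset Seg} (h : ∀ Δ ∈ M, φ Δ = 0) :
    wsum φ M = 0 := by
  rw [wsum_congr h]; simp [wsum]

theorem wsum_sub (φ ψ : Seg → ℤ) (M : Multiset Seg) :
    wsum φ M - wsum ψ M = wsum (fun Δ => φ Δ - ψ Δ) M := by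
  simp [wsum, Multiset.sum_map_sub]

/-- weight for `F` -/
def fw (a v : ℤ) (Δ : Seg) : ℤ :=
  (if Δ.1 = a + 1 ∧ Δ.2 ≤ v then 1 else 0) - (if Δ.1 = a ∧ Δ.2 < v then 1 else 0)

/-- weight for `G` -/
def gw (a : ℤ) (Δ : Seg) : ℤ :=
  (if Δ.1 = a + 1 then 1 else 0) - (if Δ.1 = a then 1 else 0)

/-- weight for `R` -/
def rw' (a u : ℤ) (Δ : Seg) : ℤ := if Δ.1 = a ∧ u ≤ Δ.2 then 1 else 0

theorem exists_bound (M : Multiset Seg) : ∃ B : ℤ, ∀ Δ ∈ M, Δ.2 < B := by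
  induction M using Multiset.induction with
  | empty => exact ⟨0, by simp⟩
  | cons x M ih =>
    obtain ⟨B, hB⟩ := ih
    refine ⟨max B (x.2 + 1), ?_⟩
    intro Δ h
    rcases Multiset.mem_cons.1 h with h | h
    · subst h; simp
    · have := hB _ h; simp [this]

theorem F_eq_G {a v : ℤ} {M : Multiset Seg} (hX : ∀ Δ ∈ M, Δ.1 = a → Δ.2 < v)
    (hY : ∀ Δ ∈ M, Δ.1 = a + 1 → Δ.2 ≤ v) : wsum (fw a v) M = wsum (gw a) M := by
  apply wsum_congr
  intro Δ h
  have h1 := hX Δ h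
  have h2 := hY Δ h
  unfold fw gw
  split_ifs <;> omega

theorem G_le_F {a v : ℤ} {M : Multiset Seg}
    (hY : ∀ Δ ∈ M, Δ.1 = a + 1 → Δ.2 ≤ v) : wsum (gw a) M ≤ wsum (fw a v) M := by
  apply wsum_le
  intro Δ h
  have h2 := hY Δ h
  unfold fw gw
  split_ifs <;> omega

theorem F_le_G {a v : ℤ} {M : Multiset Seg}
    (hX : ∀ Δ ∈ M, Δ.1 = a → Δ.2 < v) : wsum (fw a v) M ≤ wsum (gw a) M := by
  apply wsum_le
  intro Δ h
  have h2 := hX Δ h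
  unfold fw gw
  split_ifs <;> omega

/-! ### the tds process -/

theorem longStart_some {M : Multiset Seg} {i : ℤ} {Δ : Seg} (h : longStart M i = some Δ) :
    Δ ∈ M ∧ Δ.1 = i ∧ ∀ Δ' ∈ M, Δ'.1 = i → Δ'.2 ≤ Δ.2 := by
  unfold longStart at h
  rw [Option.map_eq_some_iff] at h
  obtain ⟨y, hy, rfl⟩ := h
  obtain ⟨h1, h2⟩ := msetMax_some hy
  simp only [startAt, Multiset.mem_map, Multiset.mem_filter] at h1
  obtain ⟨⟨p, q⟩, ⟨h3, h4⟩, h5⟩ := h1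
  simp only at h4 h5
  subst h4 h5
  refine ⟨h3, rfl, ?_⟩
  intro Δ' hm h'
  exact h2 _ (Multiset.mem_map_of_mem _ (by simp [startAt, hm, h']))

theorem longStart_none {M : Multiset Seg} {i : ℤ} (h : longStart M i = none) :
    ∀ Δ' ∈ M, Δ'.1 ≠ i := by
  unfold longStart at h
  rw [Option.map_eq_none_iff] at h
  have := msetMax_none h
  intro Δ' hm h'
  have h2 : Δ'.2 ∈ (startAt M i).map Prod.snd :=
    Multiset.mem_map_of_mem _ (by simp [startAt, hm, h'])
  rw [this] at h2
  simp at h2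

theorem tdsStep_none {M : Multiset Seg} {a : ℤ} (hM : ∀ Δ ∈ M, Δ.1 = a → a ≤ Δ.2)
    (h : tdsStep M a = none) :
    ∀ Δ ∈ M, ∀ Δ' ∈ M, Δ.1 = a → Δ'.1 = a + 1 → Δ'.2 ≤ Δ.2 := by
  intro Δ h1 Δ' h2 h3 h4
  unfold tdsStep at h
  cases hl : longStart M (a + 1) with
  | none => exact absurd h4 (longStart_none hl _ h2)
  | some D =>
    rw [hl] at h
    simp only at h
    obtain ⟨d1, d2, d3⟩ := longStart_some hl
    cases hl2 : msetMax (((startAt M a).filter fun Δ => Prec Δ D).map Prod.snd) with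
    | some y => rw [hl2] at h; simp at h
    | none =>
      have := msetMax_none hl2
      by_contra hc
      have h5 := d3 _ h2 h4
      have h6 := hM _ h1 h3
      have h2 : Δ.2 ∈ ((startAt M a).filter fun Δ => Prec Δ D).map Prod.snd :=
        Multiset.mem_map_of_mem _ (Multiset.mem_filter.2
          ⟨Multiset.mem_filter.2 ⟨h1, h3⟩, by omega, by omega, by omega⟩)
      rw [this] at h2
      simp at h2

theorem tdsStep_some {M M' : Multiset Seg} {a : ℤ} (hM : ∀ Δ ∈ M, Δ.1 = a → a ≤ Δ.2)
    (h : tdsStep M a = some M') :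
    ∃ x y, x < y ∧ M = (a, x) ::ₘ (a + 1, y) ::ₘ M' ∧
      (∀ Δ ∈ M, Δ.1 = a → Δ.2 < y → Δ.2 ≤ x) ∧ (∀ Δ ∈ M, Δ.1 = a + 1 → Δ.2 ≤ y) := by
  unfold tdsStep at h
  cases hl : longStart M (a + 1) with
  | none => rw [hl] at h; simp at h
  | some D =>
    rw [hl] at h
    simp only at h
    obtain ⟨d1, d2, d3⟩ := longStart_some hl
    cases hl2 : msetMax (((startAt M a).filter fun Δ => Prec Δ D).map Prod.snd) with
    | none => rw [hl2] at h; simp at h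
    | some x =>
      rw [hl2] at h
      simp only [Option.some.injEq] at h
      obtain ⟨h1, h2⟩ := msetMax_some hl2
      simp only [startAt, Multiset.mem_map, Multiset.mem_filter] at h1
      obtain ⟨⟨p, q⟩, ⟨⟨h3, h4⟩, h6⟩, h5⟩ := h1
      simp only at h4 h5
      subst h4 h5
      obtain ⟨D1, D2⟩ := D
      simp only at d2
      subst d2
      refine ⟨q, D2, h6.2.1, ?_, ?_, d3⟩
      · rw [← h, Multiset.cons_erase, Multiset.cons_erase h3]
        rw [Multiset.mem_erase_of_ne]
        · exact d1
        · simp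
      · intro Δ m1 m2 m3
        have h6 := hM _ m1 m2
        exact h2 _ (Multiset.mem_map_of_mem _ (by simp [startAt, m1, m2, Prec]; omega))

theorem tds_terminal {M : Multiset Seg} {a : ℤ}
    (h : ∀ Δ ∈ M, ∀ Δ' ∈ M, Δ.1 = a → Δ'.1 = a + 1 → Δ'.2 ≤ Δ.2) (u K : ℤ) :
    wsum (rw' a u) M ≤ K ↔ ∀ v, u ≤ v → wsum (fw a v) M - wsum (gw a) M ≤ K := by
  constructor
  · intro h1 v hv
    refine le_trans ?_ h1
    rw [wsum_sub]
    apply wsum_le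
    intro Δ _
    unfold fw gw rw'
    split_ifs <;> omega
  · intro h1
    by_cases hex : ∃ Δ ∈ M, Δ.1 = a ∧ u ≤ Δ.2
    · have : ∃ Δ ∈ M, (Δ.1 = a ∧ u ≤ Δ.2) ∧ ∀ Δ' ∈ M, Δ'.1 = a ∧ u ≤ Δ'.2 → Δ.2 ≤ Δ'.2 := by
        obtain ⟨Δ, h2, h3⟩ := hex
        obtain ⟨D, hD, hD2⟩ := Finset.exists_min_image
          (M.toFinset.filter fun Δ => Δ.1 = a ∧ u ≤ Δ.2) (fun Δ => Δ.2)
          ⟨Δ, by simp [h2, h3]⟩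
        simp only [Finset.mem_filter, Multiset.mem_toFinset] at hD hD2
        exact ⟨D, hD.1, hD.2, fun Δ' h h' => hD2 _ ⟨h, h'⟩⟩
      obtain ⟨Δ, h2, h3, h4⟩ := this
      refine le_trans ?_ (h1 Δ.2 h3.2)
      rw [wsum_sub]
      apply wsum_le
      intro D hD
      have h5 := h4 D hD
      have h6 := h Δ h2 D hD h3.1
      unfold fw gw rw'
      split_ifs <;> omega
    · push Not at hex
      obtain ⟨B, hB⟩ := exists_bound M
      have h2 : wsum (rw' a u) M = 0 := by
        apply wsum_eq_zero
        intro Δ hΔ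
        have := hex Δ hΔ
        unfold rw'
        split_ifs <;> omega
      have h3 := h1 (max B u) (by simp)
      rw [F_eq_G] at h3
      · omega
      · intro Δ hΔ _
        have := hB Δ hΔ
        simp [this]
      · intro Δ hΔ _
        have := hB Δ hΔ
        simp [this.le]

theorem tdsIterF_spec (a : ℤ) : ∀ (k : ℕ) (M : Multiset Seg), M.card ≤ k →
    (∀ Δ ∈ M, Δ.1 = a → a ≤ Δ.2) →
    tdsIterF a k M ≤ M ∧ ∀ u K, wsum (rw' a u) (tdsIterF a k M) ≤ K ↔
      ∀ v, u ≤ v → wsum (fw a v) M - wsum (gw a) M ≤ K := by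
  intro k
  induction k with
  | zero =>
    intro M hc hM
    have : M = 0 := by simpa using hc
    subst this
    exact ⟨le_refl _, fun u K => tds_terminal (by simp [tdsIterF]) u K⟩
  | succ k ih =>
    intro M hc hM
    unfold tdsIterF
    cases hs : tdsStep M a with
    | none =>
      exact ⟨le_refl _, fun u K => tds_terminal (tdsStep_none hM hs) u K⟩
    | some M' =>
      obtain ⟨x, y, hxy, hMM, hX, hY⟩ := tdsStep_some hM hs
      have hsub : M' ≤ M := by
        rw [hMM]
        exact (Multiset.le_cons_self _ _).trans (Multiset.le_cons_self _ _)
      have hc' : M'.card ≤ k := by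
        rw [hMM] at hc
        simp at hc
        omega
      obtain ⟨h1, h2⟩ := ih M' hc' (fun Δ h => hM Δ (Multiset.mem_of_le hsub h))
      refine ⟨h1.trans hsub, ?_⟩
      intro u K
      simp only
      rw [h2 u K]
      have hF : ∀ φ, wsum φ M = φ (a, x) + (φ (a + 1, y) + wsum φ M') := by
        intro φ
        rw [hMM]
        simp [wsum]
      have hg : wsum (gw a) M = wsum (gw a) M' := by
        rw [hF]; simp [gw]
      have hf : ∀ v, wsum (fw a v) M = wsum (fw a v) M' + (if y ≤ v then 1 else 0)
          - (if x < v then 1 else 0) := by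
        intro v
        rw [hF]
        simp [fw]
        split_ifs <;> omega
      have hmid : ∀ v, x < v → v < y → wsum (fw a v) M' ≤ wsum (fw a y) M' := by
        intro v h3 h4
        apply wsum_le
        intro D hD
        have h5 := hX D (Multiset.mem_of_le hsub hD)
        unfold fw
        split_ifs <;> omega
      constructor
      · intro h v hv
        have := h v hv
        rw [hf, hg]
        split_ifs <;> omega
      · intro h v hv
        have h3 := h v hv
        rw [hf, hg] at h3
        by_cases h4 : x < v ∧ v < y
        · have h5 := hmid v h4.1 h4.2
          have h6 := h y (by omega)
          rw [hf, hg] at h6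
          simp [hxy] at h6
          omega
        · split_ifs at h3 <;> omega

/-! ### upward sequences -/

theorem usNext_some {n : Multiset Seg} {p Δ : Seg} (h : usNext n p = some Δ) :
    Δ ∈ n ∧ Prec p Δ ∧ ∀ Δ' ∈ n, Prec p Δ' → Δ.1 ≤ Δ'.1 ∧ (Δ'.1 = Δ.1 → Δ'.2 ≤ Δ.2) := by
  unfold usNext at h
  cases h1 : msetMin ((n.filter fun Δ => Prec p Δ).map Prod.fst) with
  | none => rw [h1] at h; simp at h
  | some aj =>
    rw [h1] at h
    simp only [Option.map_eq_some_iff] at h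
    obtain ⟨y, hy, rfl⟩ := h
    obtain ⟨h2, h3⟩ := msetMin_some h1
    obtain ⟨h4, h5⟩ := msetMax_some hy
    simp only [Multiset.mem_map, Multiset.mem_filter] at h4
    obtain ⟨⟨p, q⟩, ⟨⟨h6, h7⟩, h8⟩, h9⟩ := h4
    simp only at h8 h9
    subst h8 h9
    refine ⟨h6, h7, ?_⟩
    intro Δ' m1 m2
    refine ⟨h3 _ (Multiset.mem_map_of_mem _ (by simp [m1, m2])), ?_⟩
    intro m3
    exact h5 _ (Multiset.mem_map_of_mem _ (by simp only [Multiset.mem_filter]; exact ⟨⟨m1, m2⟩, m3⟩))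

theorem usNext_none {n : Multiset Seg} {p : Seg} (h : usNext n p = none) :
    ∀ Δ' ∈ n, ¬ Prec p Δ' := by
  intro Δ' m1 m2
  unfold usNext at h
  have hmem : Δ' ∈ n.filter fun Δ => Prec p Δ := by simp [m1, m2]
  cases h1 : msetMin ((n.filter fun Δ => Prec p Δ).map Prod.fst) with
  | none =>
    have h2 := Multiset.mem_map_of_mem Prod.fst hmem
    rw [msetMin_none h1] at h2
    simp at h2
  | some aj =>
    rw [h1] at h
    simp only [Option.map_eq_none_iff] at h
    obtain ⟨h2, h3⟩ := msetMin_some h1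
    have h4 := msetMax_none h
    simp only [Multiset.mem_map] at h2
    obtain ⟨D, hD, hD2⟩ := h2
    have h5 : D ∈ (n.filter fun Δ => Prec p Δ).filter fun Δ => Δ.1 = aj := by
      rw [Multiset.mem_filter]; exact ⟨hD, hD2⟩
    have h6 := Multiset.mem_map_of_mem Prod.snd h5
    rw [h4] at h6
    simp at h6

theorem usAux_spec (n : Multiset Seg) : ∀ (k : ℕ) (p : Seg),
    (∀ Δ ∈ usAux n k p, Δ ∈ n ∧ p.1 < Δ.1) ∧ (usAux n k p).Nodup := by
  intro k
  induction k with
  | zero => intro p; simp [usAux]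
  | succ k ih =>
    intro p
    unfold usAux
    cases h : usNext n p with
    | none => simp
    | some Δ =>
      obtain ⟨h1, h2, h3⟩ := usNext_some h
      obtain ⟨i1, i2⟩ := ih Δ
      simp only
      refine ⟨?_, ?_⟩
      · intro D hD
        rcases List.mem_cons.1 hD with hD | hD
        · subst hD; exact ⟨h1, h2.1⟩
        · have := i1 D hD
          exact ⟨this.1, h2.1.trans this.2⟩
      · rw [List.nodup_cons]
        refine ⟨?_, i2⟩
        intro hm
        have := (i1 _ hm).2
        omega

theorem usList_spec {n : Multiset Seg} (hn : n ≠ 0) :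
    ∃ Δ, usList n = Δ :: usAux n n.card Δ ∧ Δ ∈ n ∧ (∀ Δ' ∈ n, Δ.1 ≤ Δ'.1) ∧
      (∀ Δ' ∈ n, Δ'.1 = Δ.1 → Δ'.2 ≤ Δ.2) := by
  unfold usList
  cases h1 : msetMin (n.map Prod.fst) with
  | none =>
    have := msetMin_none h1
    simp at this
    exact absurd this hn
  | some a1 =>
    obtain ⟨h2, h3⟩ := msetMin_some h1
    simp only
    cases h4 : longStart n a1 with
    | none =>
      rw [Multiset.mem_map] at h2
      obtain ⟨D, hD, hD2⟩ := h2
      exact absurd hD2 (longStart_none h4 D hD)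
    | some Δ =>
      obtain ⟨h5, h6, h7⟩ := longStart_some h4
      subst h6
      exact ⟨Δ, rfl, h5, fun Δ' h => h3 _ (Multiset.mem_map_of_mem _ h), h7⟩

theorem usList_le {n : Multiset Seg} (hn : n ≠ 0) : (usList n : Multiset Seg) ≤ n := by
  obtain ⟨Δ, h1, h2, h3, h4⟩ := usList_spec hn
  obtain ⟨i1, i2⟩ := usAux_spec n n.card Δ
  rw [h1, Multiset.le_iff_subset]
  · intro D hD
    rw [Multiset.mem_coe] at hD
    rcases List.mem_cons.1 hD with hD | hD
    · subst hD; exact h2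
    · exact (i1 D hD).1
  · rw [Multiset.coe_nodup, List.nodup_cons]
    refine ⟨?_, i2⟩
    intro hm
    have := (i1 _ hm).2
    omega

theorem row_cases {a b : ℤ} {M : Multiset Seg} (hab : a < b) (hM0 : M ≠ 0)
    (hM : ∀ Δ ∈ M, a ≤ Δ.1 ∧ b ≤ Δ.2) :
    (∃ x y rest, usList M = (a, x) :: (a + 1, y) :: rest ∧ x < y ∧
      (∀ Δ ∈ M, Δ.1 = a → Δ.2 ≤ x) ∧ (∀ Δ ∈ M, Δ.1 = a + 1 → Δ.2 ≤ y) ∧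
      ∀ Δ ∈ rest, a + 2 ≤ Δ.1) ∨
    (∃ x rest, usList M = (a, x) :: rest ∧
      (∀ Δ ∈ M, Δ.1 = a → Δ.2 ≤ x) ∧ (∀ Δ ∈ M, Δ.1 = a + 1 → Δ.2 ≤ x) ∧
      ∀ Δ ∈ rest, a + 2 ≤ Δ.1) ∨
    (∃ y rest, usList M = (a + 1, y) :: rest ∧
      (∀ Δ ∈ M, Δ.1 ≠ a) ∧ (∀ Δ ∈ M, Δ.1 = a + 1 → Δ.2 ≤ y) ∧
      ∀ Δ ∈ rest, a + 2 ≤ Δ.1) ∨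
    ((∀ Δ ∈ M, Δ.1 ≠ a) ∧ (∀ Δ ∈ M, Δ.1 ≠ a + 1)) := by
  obtain ⟨Δ, h1, h2, h3, h4⟩ := usList_spec hM0
  obtain ⟨s, x⟩ := Δ
  obtain ⟨i1, i2⟩ := usAux_spec M M.card (s, x)
  have hs := hM _ h2
  simp only at hs h3 h4 i1
  by_cases c1 : s = a
  · subst c1
    obtain ⟨k, hk⟩ : ∃ k, M.card = k + 1 := by
      exact Nat.exists_eq_add_one_of_ne_zero (by simpa using hM0)
    rw [hk] at h1
    cases hN : usNext M (s, x) with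
    | none =>
      have h5 := usNext_none hN
      right; left
      refine ⟨x, [], ?_, h4, ?_, by simp⟩
      · rw [h1]; simp [usAux, hN]
      · intro D hD hD1
        have := h5 D hD
        simp only [Prec] at this
        omega
    | some E =>
      obtain ⟨e1, e2, e3⟩ := usNext_some hN
      obtain ⟨j1, j2⟩ := usAux_spec M k E
      have hl : usList M = (s, x) :: E :: usAux M k E := by
        rw [h1]; simp [usAux, hN]
      simp only [Prec] at e2 e3
      by_cases c2 : E.1 = s + 1
      · left
        obtain ⟨E1, y⟩ := E
        simp only at c2 e2 e3 j1
        subst c2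
        refine ⟨x, y, _, hl, e2.2.1, h4, ?_, ?_⟩
        · intro D hD hD1
          by_contra hc
          have := (e3 D hD (by omega)).2 hD1
          omega
        · intro D hD
          have := (j1 D hD).2
          omega
      · right; left
        refine ⟨x, _, hl, h4, ?_, ?_⟩
        · intro D hD hD1
          by_contra hc
          have := (e3 D hD (by omega)).1
          omega
        · intro D hD
          rcases List.mem_cons.1 hD with hD | hD
          · subst hD; omega
          · have := (j1 D hD).2
            omega
  · right; right
    by_cases c2 : s = a + 1
    · subst c2
      left
      refine ⟨x, _, h1, ?_, h4, ?_⟩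
      · intro D hD
        have := h3 D hD
        omega
      · intro D hD
        have := (i1 D hD).2
        omega
    · right
      constructor <;>
      · intro D hD
        have := h3 D hD
        omega

/-! ### the selection -/

theorem findRowD_mem : ∀ (row : List Seg) (t : ℤ) (Δ : Seg), findRowD row t = some Δ → Δ ∈ row
  | [], t, Δ, h => by simp [findRowD] at h
  | [D], t, Δ, h => by
    simp only [findRowD] at h
    split_ifs at h
    simpa using h.symm
  | D :: D' :: rest, t, Δ, h => by
    unfold findRowD at h
    split_ifs at h
    · simp only [Option.some.injEq] at h
      subst h
      simp
    · exact List.mem_cons_of_mem _ (findRowD_mem (D' :: rest) t Δ h)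

theorem findRowD_void {Δ : Seg} {rest : List Seg} {t : ℤ} (h : t < Δ.1) :
    findRowD (Δ :: rest) t = some Δ := by
  cases rest with
  | nil => simp [findRowD, intSubB, h]
  | cons D r => simp [findRowD, intSubB, h]

theorem findRowD_skip {Δ Δ' : Seg} {rest : List Seg} {t : ℤ} (h : Δ.1 ≤ t) (h' : Δ'.1 - 2 < t) :
    findRowD (Δ :: Δ' :: rest) t = findRowD (Δ' :: rest) t := by
  conv_lhs => unfold findRowD
  rw [if_neg]
  simp [intSubB]
  omega

theorem findRowD_first {Δ : Seg} {rest : List Seg} {t : ℤ} (h : t ≤ Δ.2)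
    (h' : ∀ D ∈ rest, t + 2 ≤ D.1) :
    findRowD (Δ :: rest) t = some Δ := by
  cases rest with
  | nil => simp [findRowD, intSubB, h]
  | cons D r =>
    have := h' D (by simp)
    unfold findRowD
    rw [if_pos]
    simp [intSubB]
    omega

/-- new multisegment after treating a row -/
def stepN (row : List Seg) (N : Multiset Seg) (t : ℤ) : Multiset Seg :=
  match findRowD row t with
  | none => ↑row + N
  | some Δ => pushSeg ((↑row + N).erase Δ) (t + 1) Δ.2

/-- new top after treating a row -/
def stepT (row : List Seg) (t : ℤ) : ℤ :=
  match findRowD row t with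
  | none => t
  | some Δ => Δ.1 - 1

theorem mem_pushSeg {A : Multiset Seg} {s e : ℤ} {D : Seg} (h : D ∈ pushSeg A s e) :
    D ∈ A ∨ D = (s, e) := by
  unfold pushSeg at h
  split_ifs at h
  · simpa using h
  · exact Or.inl h

theorem wsum_push {A : Multiset Seg} {φ : Seg → ℤ} {s e : ℤ} (h : s ≤ e) :
    wsum φ (pushSeg A s e) = wsum φ A + φ (s, e) := by
  unfold pushSeg
  rw [if_pos h, wsum_add, wsum_single]

theorem fw_far {a v : ℤ} {Δ : Seg} (h : a + 2 ≤ Δ.1) : fw a v Δ = 0 := by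
  unfold fw
  split_ifs <;> omega

theorem gw_far {a : ℤ} {Δ : Seg} (h : a + 2 ≤ Δ.1) : gw a Δ = 0 := by
  unfold gw
  split_ifs <;> omega

theorem wsum_push_far {A : Multiset Seg} {a v s e : ℤ} (h : a + 2 ≤ s) :
    wsum (fw a v) (pushSeg A s e) = wsum (fw a v) A := by
  unfold pushSeg
  split_ifs
  · rw [wsum_add, wsum_single, fw_far (by simpa using h), add_zero]
  · rfl

theorem push_erase_self {A : Multiset Seg} {Δ : Seg} (h : Δ ∈ A) (h' : Δ.1 ≤ Δ.2) :
    pushSeg (A.erase Δ) Δ.1 Δ.2 = A := by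
  unfold pushSeg
  rw [if_pos h', add_comm, Multiset.singleton_add]
  exact Multiset.cons_erase h

/-- common part of the invariant -/
def InvBase (a b : ℤ) (M N : Multiset Seg) : Prop :=
  ∀ D ∈ N, b ≤ D.2 ∧ (D.1 = a → D ∈ M) ∧ (D.1 = a + 1 → D ∈ M ∨ (a, D.2) ∈ M)

def InvA (a : ℤ) (M N : Multiset Seg) (t : ℤ) : Prop :=
  a + 1 ≤ t ∧ ∀ v, wsum (fw a v) N = wsum (fw a v) M

def InvB (a : ℤ) (M N : Multiset Seg) (t : ℤ) : Prop :=
  t = a ∧ ∃ e, (a + 1, e) ∈ M ∧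
    (∀ v, wsum (fw a v) N = wsum (fw a v) M - (if e ≤ v then 1 else 0)) ∧
    ∀ v, e ≤ v → wsum (fw a v) M ≤ wsum (gw a) M

def InvC (a : ℤ) (M N : Multiset Seg) (t : ℤ) : Prop :=
  t = a - 1 ∧ (∃ x, (a, x) ∈ M) ∧
    ∀ K, (∀ v, wsum (fw a v) M ≤ K) ↔ (∀ v, wsum (fw a v) N ≤ K)

def Inv (a b : ℤ) (M N : Multiset Seg) (t : ℤ) : Prop :=
  InvBase a b M N ∧ (InvA a M N t ∨ InvB a M N t ∨ InvC a M N t)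

theorem InvBase.row {a b : ℤ} {M N : Multiset Seg} (h : InvBase a b M N) {row : List Seg}
    (hr : ∀ D ∈ row, b ≤ D.2) : InvBase a b (↑row + M) (↑row + N) := by
  intro D hD
  simp only [Multiset.mem_add, Multiset.mem_coe] at hD ⊢
  rcases hD with hD | hD
  · exact ⟨hr D hD, fun _ => Or.inl hD, fun _ => Or.inl (Or.inl hD)⟩
  · obtain ⟨h1, h2, h3⟩ := h D hD
    refine ⟨h1, fun h => Or.inr (h2 h), fun h => ?_⟩
    rcases h3 h with h | h
    · exact Or.inl (Or.inr h)
    · exact Or.inr (Or.inr h)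

theorem InvBase.push {a b : ℤ} {M N : Multiset Seg} (h : InvBase a b M N) {Δ : Seg} {s e : ℤ}
    (he : b ≤ e) (hs : a + 2 ≤ s ∨ (s = a + 1 ∧ (a, e) ∈ M)) :
    InvBase a b M (pushSeg (N.erase Δ) s e) := by
  intro D hD
  rcases mem_pushSeg hD with hD | hD
  · exact h D (Multiset.mem_of_mem_erase hD)
  · subst hD
    refine ⟨he, ?_, ?_⟩
    · intro h
      simp only at h
      omega
    · intro h
      simp only at h ⊢
      rcases hs with hs | hs
      · omega
      · exact Or.inr hs.2

theorem wsum_row {a : ℤ} {rest : List Seg} (h : ∀ D ∈ rest, a + 2 ≤ D.1) :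
    (∀ v, wsum (fw a v) (rest : Multiset Seg) = 0) ∧ wsum (gw a) (rest : Multiset Seg) = 0 :=
  ⟨fun v => wsum_eq_zero fun D hD => fw_far (h D (by simpa using hD)),
    wsum_eq_zero fun D hD => gw_far (h D (by simpa using hD))⟩

/-- a step from state A which does not touch starts `a`, `a+1` -/
theorem stepA_far {a b : ℤ} {M N : Multiset Seg} {t : ℤ} {row : List Seg}
    (hb : InvBase a b M N) (hA : InvA a M N t) (hr : ∀ D ∈ row, b ≤ D.2)
    (h : ∀ Δ, findRowD row t = some Δ → a + 2 ≤ Δ.1) :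
    Inv a b (↑row + M) (stepN row N t) (stepT row t) := by
  unfold stepN stepT
  have hb' := hb.row hr
  cases hf : findRowD row t with
  | none =>
    refine ⟨hb', Or.inl ⟨hA.1, fun v => ?_⟩⟩
    simp only [wsum_add, hA.2 v]
  | some Δ =>
    have h1 := h Δ hf
    have h2 := findRowD_mem _ _ _ hf
    have h3 := hA.1
    refine ⟨hb'.push (hr _ h2) (Or.inl (by omega)), Or.inl ⟨by simp only; omega, fun v => ?_⟩⟩
    rw [wsum_push_far (by omega), wsum_erase _ (by simp [h2]), fw_far h1, wsum_add, wsum_add,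
      hA.2 v, sub_zero]

theorem step_triv {row : List Seg} {N : Multiset Seg} {t : ℤ} {Δ : Seg}
    (hf : findRowD row t = some Δ) (h1 : Δ.1 = t + 1) (h2 : Δ.1 ≤ Δ.2) :
    stepN row N t = ↑row + N ∧ stepT row t = t := by
  unfold stepN stepT
  rw [hf]
  simp only
  refine ⟨?_, by omega⟩
  rw [← h1]
  exact push_erase_self (by simp [findRowD_mem _ _ _ hf]) h2

theorem sup_unmatched {a x : ℤ} {M : Multiset Seg} (hX : ∀ Δ ∈ M, Δ.1 = a → Δ.2 ≤ x)
    (hY : ∀ Δ ∈ M, Δ.1 = a + 1 → Δ.2 ≤ x) (K : ℤ) :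
    (∀ v, wsum (fw a v) M - (if x < v then 1 else 0) ≤ K) ↔ ∀ v, wsum (fw a v) M ≤ K := by
  constructor
  · intro h v
    by_cases hv : x < v
    · rw [F_eq_G (fun D h1 h2 => (hX D h1 h2).trans_lt hv) (fun D h1 h2 => (hY D h1 h2).trans hv.le)]
      have h1 := h x
      have h2 := G_le_F hY
      simp at h1
      omega
    · have := h v
      simpa [hv] using this
  · intro h v
    have := h v
    split_ifs <;> omega

theorem sup_matched {a x y : ℤ} {M : Multiset Seg} (hxy : x < y)
    (hX : ∀ Δ ∈ M, Δ.1 = a → Δ.2 ≤ x)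
    (hY : ∀ Δ ∈ M, Δ.1 = a + 1 → Δ.2 ≤ y) (K : ℤ) :
    (∀ v, wsum (fw a v) M + (if y ≤ v then 1 else 0) - (if x < v then 1 else 0) ≤ K) ↔
      ∀ v, wsum (fw a v) M ≤ K := by
  constructor
  · intro h v
    have h0 := h v
    by_cases hv : x < v ∧ v < y
    · have h1 := h y
      have h2 := G_le_F hY
      have h3 := F_le_G (fun D h1 h2 => (hX D h1 h2).trans_lt hv.1)
      simp [hxy] at h1
      omega
    · split_ifs at h0 <;> omega
  · intro h v
    have := h v
    split_ifs <;> omega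

theorem step_inv {a b : ℤ} (hab : a < b) {M N M' : Multiset Seg} {t : ℤ} {row : List Seg}
    (hI : Inv a b M N t) (h0 : M' ≠ 0) (hM' : ∀ Δ ∈ M', a ≤ Δ.1 ∧ b ≤ Δ.2)
    (hrow : usList M' = row) (hMM : M' = ↑row + M) :
    Inv a b M' (stepN row N t) (stepT row t) := by
  obtain ⟨hb, hI⟩ := hI
  have hr : ∀ D ∈ row, a ≤ D.1 ∧ b ≤ D.2 := fun D hD => hM' D (by simp [hMM, hD])
  have hr2 : ∀ D ∈ row, b ≤ D.2 := fun D hD => (hr D hD).2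
  have hsub : ∀ D ∈ M, D ∈ M' := fun D hD => by simp [hMM, hD]
  have hb' := hb.row hr2
  rw [← hMM] at hb'
  rcases row_cases hab h0 hM' with ⟨x, y, rest, e1, hxy, hX, hY, hrest⟩ |
    ⟨x, rest, e1, hX, hY, hrest⟩ | ⟨y, rest, e1, hX, hY, hrest⟩ | ⟨hX, hY⟩
  · -- matched row
    rw [hrow] at e1
    have hy : b ≤ y := hr2 (a + 1, y) (by simp [e1])
    have hx : b ≤ x := hr2 (a, x) (by simp [e1])
    obtain ⟨w1, w2⟩ := wsum_row hrest
    have hF : ∀ (A : Multiset Seg) v, wsum (fw a v) (↑row + A) =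
        wsum (fw a v) A + (if y ≤ v then 1 else 0) - (if x < v then 1 else 0) := by
      intro A v
      rw [wsum_add, e1, wsum_cons, wsum_cons, w1]
      simp [fw]
      split_ifs <;> omega
    have hG : ∀ (A : Multiset Seg), wsum (gw a) (↑row + A) = wsum (gw a) A := by
      intro A
      rw [wsum_add, e1, wsum_cons, wsum_cons, w2]
      simp [gw]
    rcases hI with hA | ⟨rfl, e, he, hB1, hB2⟩ | ⟨rfl, hC1, hC2⟩
    · have hs : findRowD row t = findRowD ((a + 1, y) :: rest) t := by
        rw [e1]
        have := hA.1
        exact findRowD_skip (by simp only; omega) (by simp only; omega)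
      by_cases hf : findRowD row t = some (a + 1, y)
      · have hA1 := hA.1
        have hA2 := hA.2
        unfold stepN stepT
        rw [hf]
        simp only
        refine ⟨?_, Or.inr (Or.inl ⟨by omega, y, by simp [hMM, e1], ?_, ?_⟩)⟩
        · exact hb'.push hy (Or.inl (by omega))
        · intro v
          rw [wsum_push_far (by omega), wsum_erase _ (by simp [e1]), hMM, hF, hF, hA2 v]
          simp [fw]
        · intro v hv
          exact F_le_G (fun D h1 h2 => by have := hX D h1 h2; omega)
      · rw [hMM]
        apply stepA_far hb hA hr2
        intro Δ hΔ
        have h1 := hΔ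
        rw [hs] at h1
        rcases List.mem_cons.1 (findRowD_mem _ _ _ h1) with h | h
        · rw [h] at hΔ; exact absurd hΔ hf
        · exact hrest _ h
    · have hf : findRowD row t = some (t + 1, y) := by
        rw [e1, findRowD_skip (by simp) (by simp only; omega)]
        exact findRowD_void (by simp)
      obtain ⟨s1, s2⟩ := step_triv (N := N) hf rfl (by simp only; omega)
      rw [s1, s2]
      refine ⟨hb', Or.inr (Or.inl ⟨rfl, e, hsub _ he, ?_, ?_⟩)⟩
      · intro v
        rw [hMM, hF, hF, hB1]
        ring
      · intro v hv
        have := hB2 v hv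
        rw [hMM, hF, hG]
        split_ifs <;> omega
    · have hf : findRowD row (a - 1) = some (a, x) := by
        rw [e1]
        exact findRowD_void (by simp)
      obtain ⟨s1, s2⟩ := step_triv (N := N) hf (by simp) (by simp only; omega)
      rw [s1, s2]
      refine ⟨hb', Or.inr (Or.inr ⟨rfl, ⟨x, by simp [hMM, e1]⟩, ?_⟩)⟩
      intro K
      rw [hMM]
      simp only [hF]
      rw [sup_matched hxy, sup_matched hxy, hC2 K]
      · exact fun D h1 h2 => hX D (hsub D ((hb D h1).2.1 h2)) h2
      · intro D h1 h2
        rcases (hb D h1).2.2 h2 with h | h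
        · exact hY D (hsub _ h) h2
        · have := hX _ (hsub _ h) rfl
          simp only at this
          omega
      · exact fun D h1 h2 => hX D (hsub D h1) h2
      · exact fun D h1 h2 => hY D (hsub D h1) h2
  · -- unmatched x
    rw [hrow] at e1
    have hx : b ≤ x := hr2 (a, x) (by simp [e1])
    obtain ⟨w1, w2⟩ := wsum_row hrest
    have hF : ∀ (A : Multiset Seg) v, wsum (fw a v) (↑row + A) =
        wsum (fw a v) A - (if x < v then 1 else 0) := by
      intro A v
      rw [wsum_add, e1, wsum_cons, w1]
      simp [fw]
      split_ifs <;> omega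
    have hXM : ∀ D ∈ M, D.1 = a → D.2 ≤ x := fun D h1 h2 => hX D (hsub D h1) h2
    have hYM : ∀ D ∈ M, D.1 = a + 1 → D.2 ≤ x := fun D h1 h2 => hY D (hsub D h1) h2
    have hxM : (a, x) ∈ M' := by simp [hMM, e1]
    have hxr : ∀ A : Multiset Seg, (a, x) ∈ (↑row + A : Multiset Seg) := by
      intro A; simp [e1]
    rcases hI with hA | ⟨rfl, e, he, hB1, hB2⟩ | ⟨rfl, hC1, hC2⟩
    · by_cases hf : findRowD row t = some (a, x)
      · have hA1 := hA.1
        have hA2 := hA.2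
        unfold stepN stepT
        rw [hf]
        simp only
        refine ⟨?_, Or.inr (Or.inr ⟨rfl, ⟨x, hxM⟩, ?_⟩)⟩
        · exact hb'.push hx (Or.inl (by omega))
        · intro K
          have h2 : ∀ v, wsum (fw a v) (pushSeg ((↑row + N).erase (a, x)) (t + 1) x) =
              wsum (fw a v) M := by
            intro v
            rw [wsum_push_far (by omega), wsum_erase _ (hxr N), hF, hA2 v]
            simp [fw]
          simp only [h2]
          rw [hMM]
          simp only [hF]
          exact sup_unmatched hXM hYM K
      · rw [hMM]
        apply stepA_far hb hA hr2
        intro Δ hΔ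
        have h1 := hΔ
        rw [e1] at h1
        rcases List.mem_cons.1 (findRowD_mem _ _ _ h1) with h | h
        · rw [h] at hΔ; exact absurd hΔ hf
        · exact hrest _ h
    · have hf : findRowD row t = some (t, x) := by
        rw [e1]
        exact findRowD_first (by simp only; omega) hrest
      unfold stepN stepT
      rw [hf]
      simp only
      refine ⟨hb'.push hx (Or.inr ⟨rfl, hxM⟩), Or.inr (Or.inr ⟨rfl, ⟨x, hxM⟩, ?_⟩)⟩
      intro K
      have h2 : ∀ v, wsum (fw t v) (pushSeg ((↑row + N).erase (t, x)) (t + 1) x) =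
          wsum (fw t v) M - (if e ≤ v then 1 else 0) + (if x ≤ v then 1 else 0) := by
        intro v
        rw [wsum_push (by omega), wsum_erase _ (hxr N), hF, hB1 v]
        simp [fw]
      have hex : e ≤ x := hYM _ he rfl
      have g1 := G_le_F hYM
      have g2 : wsum (fw t (x + 1)) M = wsum (gw t) M :=
        F_eq_G (fun D h1 h2 => by have := hXM D h1 h2; omega)
          (fun D h1 h2 => by have := hYM D h1 h2; omega)
      simp only [h2]
      rw [hMM]
      simp only [hF]
      rw [sup_unmatched hXM hYM K]
      constructor
      · intro h v
        have q1 := h v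
        have q2 := h x
        split_ifs <;> omega
      · intro h v
        have q1 := h v
        have q2 := h (x + 1)
        have q3 := hB2 v
        rw [if_pos (by omega), if_pos (by omega)] at q2
        split_ifs at q1 <;> omega
    · have hf : findRowD row (a - 1) = some (a, x) := by
        rw [e1]
        exact findRowD_void (by simp)
      obtain ⟨s1, s2⟩ := step_triv (N := N) hf (by simp) (by simp only; omega)
      rw [s1, s2]
      refine ⟨hb', Or.inr (Or.inr ⟨rfl, ⟨x, hxM⟩, ?_⟩)⟩
      intro K
      rw [hMM]
      simp only [hF]
      rw [sup_unmatched hXM hYM, sup_unmatched, hC2 K]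
      · exact fun D h1 h2 => hXM D ((hb D h1).2.1 h2) h2
      · intro D h1 h2
        rcases (hb D h1).2.2 h2 with h | h
        · exact hYM D h h2
        · exact hXM (a, D.2) h rfl
  · -- no x
    rw [hrow] at e1
    have hy : b ≤ y := hr2 (a + 1, y) (by simp [e1])
    obtain ⟨w1, w2⟩ := wsum_row hrest
    have hF : ∀ (A : Multiset Seg) v, wsum (fw a v) (↑row + A) =
        wsum (fw a v) A + (if y ≤ v then 1 else 0) := by
      intro A v
      rw [wsum_add, e1, wsum_cons, w1]
      simp [fw]
      split_ifs <;> omega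
    have hG : ∀ (A : Multiset Seg), wsum (gw a) (↑row + A) = wsum (gw a) A + 1 := by
      intro A
      rw [wsum_add, e1, wsum_cons, w2]
      simp [gw]
      omega
    rcases hI with hA | ⟨rfl, e, he, hB1, hB2⟩ | ⟨rfl, ⟨x, hC1⟩, hC2⟩
    · by_cases hf : findRowD row t = some (a + 1, y)
      · have hA1 := hA.1
        have hA2 := hA.2
        unfold stepN stepT
        rw [hf]
        simp only
        refine ⟨?_, Or.inr (Or.inl ⟨by omega, y, by simp [hMM, e1], ?_, ?_⟩)⟩
        · exact hb'.push hy (Or.inl (by omega))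
        · intro v
          rw [wsum_push_far (by omega), wsum_erase _ (by simp [e1]), hMM, hF, hF, hA2 v]
          simp [fw]
        · intro v hv
          exact F_le_G (fun D h1 h2 => absurd h2 (hX D h1))
      · rw [hMM]
        apply stepA_far hb hA hr2
        intro Δ hΔ
        have h1 := hΔ
        rw [e1] at h1
        rcases List.mem_cons.1 (findRowD_mem _ _ _ h1) with h | h
        · rw [h] at hΔ; exact absurd hΔ hf
        · exact hrest _ h
    · have hf : findRowD row t = some (t + 1, y) := by
        rw [e1]
        exact findRowD_void (by simp)
      obtain ⟨s1, s2⟩ := step_triv (N := N) hf rfl (by simp only; omega)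
      rw [s1, s2]
      refine ⟨hb', Or.inr (Or.inl ⟨rfl, e, hsub _ he, ?_, ?_⟩)⟩
      · intro v
        rw [hMM, hF, hF, hB1]
        ring
      · intro v hv
        have := hB2 v hv
        rw [hMM, hF, hG]
        split_ifs <;> omega
    · exact absurd rfl (hX _ (hsub _ hC1))
  · -- neither
    rcases hI with hA | ⟨rfl, e, he, hB1, hB2⟩ | ⟨rfl, ⟨x, hC1⟩, hC2⟩
    · rw [hMM]
      apply stepA_far hb hA hr2
      intro Δ hΔ
      have h1 := findRowD_mem _ _ _ hΔ
      have h2 : Δ ∈ M' := by simp [hMM, h1]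
      have h3 := hX _ h2
      have h4 := hY _ h2
      have h5 := hM' _ h2
      omega
    · exact absurd rfl (hY _ (hsub _ he))
    · exact absurd rfl (hX _ (hsub _ hC1))

/-- top after a selection list -/
def finTop (l : List (Seg × ℤ)) (t : ℤ) : ℤ :=
  match l.getLast? with
  | none => t
  | some p => p.1.1 - 1

theorem finTop_cons (p : Seg × ℤ) (l : List (Seg × ℤ)) (t : ℤ) :
    finTop (p :: l) t = finTop l (p.1.1 - 1) := by
  unfold finTop
  cases l with
  | nil => simp
  | cons q r => rw [List.getLast?_cons_cons, List.getLast?_eq_some_getLast (by simp)]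

theorem finTop_append (p : Seg × ℤ) (l : List (Seg × ℤ)) (t : ℤ) :
    finTop (l ++ [p]) t = p.1.1 - 1 := by
  unfold finTop
  simp

theorem selAuxD_cons (r : List Seg) (rows : List (List Seg)) : ∀ (k : ℕ) (t : ℤ),
    selAuxD (r :: rows) (k + 1) t = selAuxD rows k t ++
      (match findRowD r (finTop (selAuxD rows k t) t) with
        | none => []
        | some Δ => [(Δ, finTop (selAuxD rows k t) t + 1)]) := by
  intro k
  induction k with
  | zero =>
    intro t
    simp only [selAuxD, finTop]
    simp
    cases findRowD r t <;> simp
  | succ k ih =>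
    intro t
    rw [selAuxD]
    have : (r :: rows).getD (k + 1) [] = rows.getD k [] := by simp
    rw [this]
    conv_rhs => rw [selAuxD]
    cases h : findRowD (rows.getD k []) t with
    | none =>
      simp only
      rw [ih]
    | some Δ =>
      simp only
      rw [ih, finTop_cons, List.cons_append]

/-- the truncation fold -/
def trunc (l : List (Seg × ℤ)) (m : Multiset Seg) : Multiset Seg :=
  l.foldl (fun acc p => pushSeg (acc.erase p.1) p.2 p.1.2) m

theorem pushSeg_add (C A : Multiset Seg) (s e : ℤ) :
    pushSeg (C + A) s e = C + pushSeg A s e := by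
  unfold pushSeg
  split_ifs
  · rw [add_assoc]
  · rfl

theorem le_pushSeg (A : Multiset Seg) (s e : ℤ) : A ≤ pushSeg A s e := by
  unfold pushSeg
  split_ifs
  · exact Multiset.le_add_right _ _
  · exact le_refl _

theorem trunc_add (C : Multiset Seg) : ∀ (l : List (Seg × ℤ)) (M : Multiset Seg),
    ((l.map Prod.fst : List Seg) : Multiset Seg) ≤ M → trunc l (C + M) = C + trunc l M := by
  intro l
  induction l with
  | nil => intro M _; rfl
  | cons p l ih =>
    intro M h
    have hp : p.1 ∈ M := Multiset.mem_of_le h (by simp)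
    have h2 : ((l.map Prod.fst : List Seg) : Multiset Seg) ≤ M.erase p.1 := by
      rw [List.map_cons, ← Multiset.cons_coe] at h
      have := Multiset.erase_le_erase p.1 h
      simpa using this
    have : trunc (p :: l) (C + M) = trunc l (pushSeg ((C + M).erase p.1) p.2 p.1.2) := rfl
    rw [this, Multiset.erase_add_right_pos _ hp, pushSeg_add, ih _ (h2.trans (le_pushSeg _ _ _))]
    rfl

theorem sel_inv {a b : ℤ} (hab : a < b) : ∀ (k : ℕ) (M : Multiset Seg), M.card ≤ k →
    (∀ Δ ∈ M, a ≤ Δ.1 ∧ b ≤ Δ.2) →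
    ∀ l, l = selAuxD (usDecomp k M) (usDecomp k M).length b →
    ((l.map Prod.fst : List Seg) : Multiset Seg) ≤ M ∧ Inv a b M (trunc l M) (finTop l b) := by
  have hzero : ∀ l, l = selAuxD [] 0 b →
      ((l.map Prod.fst : List Seg) : Multiset Seg) ≤ 0 ∧ Inv a b 0 (trunc l 0) (finTop l b) := by
    intro l hl
    simp only [selAuxD] at hl
    subst hl
    refine ⟨by simp, by simp [InvBase, trunc], Or.inl ⟨?_, ?_⟩⟩
    · simp [finTop]; omega
    · intro v; rfl
  intro k
  induction k with
  | zero =>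
    intro M hc hM l hl
    have : M = 0 := by simpa using hc
    subst this
    exact hzero l hl
  | succ k ih =>
    intro M hc hM l hl
    unfold usDecomp at hl
    by_cases h0 : M = 0
    · subst h0
      exact hzero l (by simpa using hl)
    · rw [if_neg h0, List.length_cons, selAuxD_cons] at hl
      have hle := usList_le h0
      have hMM : M = ↑(usList M) + (M - ↑(usList M)) := (add_tsub_cancel_of_le hle).symm
      obtain ⟨Δ0, hΔ0, _⟩ := usList_spec h0
      have hc' : (M - ↑(usList M)).card ≤ k := by
        have := congrArg Multiset.card hMM
        rw [Multiset.card_add, Multiset.coe_card] at this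
        rw [hΔ0] at this ⊢
        simp only [List.length_cons] at this
        omega
      obtain ⟨i1, i2⟩ := ih (M - ↑(usList M)) hc'
        (fun D hD => hM D (Multiset.mem_of_le (Multiset.sub_le_self _ _) hD)) _ rfl
      have hs := step_inv hab i2 h0 hM rfl hMM
      generalize selAuxD (usDecomp k (M - ↑(usList M))) (usDecomp k (M - ↑(usList M))).length b
        = l' at *
      have ht : trunc l' M = ↑(usList M) + trunc l' (M - ↑(usList M)) := by
        conv_lhs => rw [hMM]
        exact trunc_add _ _ _ i1
      unfold stepN stepT at hs
      cases hf : findRowD (usList M) (finTop l' b) with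
      | none =>
        rw [hf] at hs hl
        simp only [List.append_nil] at hs hl
        subst hl
        refine ⟨i1.trans (Multiset.sub_le_self _ _), ?_⟩
        rw [ht]
        exact hs
      | some Δ =>
        rw [hf] at hs hl
        simp only at hs hl
        subst hl
        refine ⟨?_, ?_⟩
        · rw [List.map_append, ← Multiset.coe_add, add_comm]
          conv_rhs => rw [hMM]
          apply add_le_add _ i1
          simp only [List.map_cons, List.map_nil, Multiset.coe_singleton, Multiset.singleton_le]
          simpa using findRowD_mem _ _ _ hf
        · have : trunc (l' ++ [(Δ, finTop l' b + 1)]) M =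
              pushSeg ((trunc l' M).erase Δ) (finTop l' b + 1) Δ.2 := by
            simp [trunc]
          rw [this, ht, finTop_append]
          exact hs

theorem count_eq_R (a u : ℤ) (M : Multiset Seg) :
    (M.count (a, u) : ℤ) = wsum (rw' a u) M - wsum (rw' a (u + 1)) M := by
  rw [wsum_sub]
  induction M using Multiset.induction with
  | empty => simp [wsum]
  | cons D M ih =>
    rw [← Multiset.singleton_add, wsum_add, wsum_single, Multiset.count_add, ← ih]
    push_cast
    congr 1
    obtain ⟨p, q⟩ := D
    rw [Multiset.count_singleton]
    simp only [rw', Prod.mk.injEq]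
    split_ifs <;> simp <;> omega

/-- if `𝒟^Lang_{[a,b]}(m) ≠ ∞` and `𝒟_{[a]}(m) = m - Δₐ + ⁻Δₐ` for
some `Δₐ ∈ m[a]` with `Δₐ ∉ m_{[a,b]}`, then the `tds(·,a)` processes on `m`
and on `𝒟^Lang_{[a,b]}(m)` leave the same multiset of segments starting at `a`
and not lying in `m_{[a,b]}`. -/
theorem stmt2 (m : Multiset Seg) (hm : IsMS m) (a b : ℤ) (hab : a ≤ b)
    (n : Multiset Seg) (hD : DLang a b m = some n)
    (Δa : Seg) (hmem : Δa ∈ m) (hstart : Δa.1 = a) (hnr : Δa ∉ mRange m a b)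
    (hrho : Drho a m = some (pushSeg (m.erase Δa) (a + 1) Δa.2)) :
    (tdsIter a m).filter (fun Δ => Δ.1 = a ∧ Δ ∉ mRange m a b) =
      (tdsIter a n).filter (fun Δ => Δ.1 = a ∧ Δ ∉ mRange m a b) := by
  have hab' : a < b := by
    by_contra hc
    apply hnr
    have h1 := hm _ hmem
    simp only [mRange, Multiset.mem_filter]
    exact ⟨hmem, by omega, by omega, by omega⟩
  have hm1 : ∀ Δ ∈ mRange m a b, a ≤ Δ.1 ∧ b ≤ Δ.2 := by
    intro D hD
    simp only [mRange, Multiset.mem_filter] at hD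
    exact ⟨hD.2.1, hD.2.2.2⟩
  obtain ⟨i1, i2⟩ := sel_inv hab' _ _ le_rfl hm1 _ rfl
  unfold DLang at hD
  simp only at hD
  generalize selAuxD (usDecomp (mRange m a b).card (mRange m a b))
    (usDecomp (mRange m a b).card (mRange m a b)).length b = l at *
  have hfin : finTop l b = a - 1 ∧ n = trunc l m := by
    unfold finTop
    cases hl : l.getLast? with
    | none => rw [hl] at hD; simp at hD
    | some p =>
      rw [hl] at hD
      simp only at hD
      split_ifs at hD with h
      simp only [Option.some.injEq] at hD
      exact ⟨by simp [h], hD.symm⟩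
  obtain ⟨hft, hn⟩ := hfin
  have hC : ∃ C, m = C + mRange m a b ∧ ∀ D ∈ C, D.1 = a ∨ D.1 = a + 1 → D.2 < b := by
    refine ⟨m.filter fun Δ => ¬ (a ≤ Δ.1 ∧ Δ.1 ≤ b + 1 ∧ b ≤ Δ.2), ?_, ?_⟩
    · rw [add_comm]
      exact (Multiset.filter_add_not _ m).symm
    · intro D hD h
      rw [Multiset.mem_filter] at hD
      have := hD.2
      omega
  obtain ⟨C, hmC, hCb⟩ := hC
  have hnC : n = C + trunc l (mRange m a b) := by
    rw [hn]
    conv_lhs => rw [hmC]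
    exact trunc_add _ _ _ i1
  rw [hft] at i2
  obtain ⟨hb, hI⟩ := i2
  have hsup : ∀ K, (∀ v, wsum (fw a v) (mRange m a b) ≤ K) ↔
      (∀ v, wsum (fw a v) (trunc l (mRange m a b)) ≤ K) := by
    rcases hI with h | h | h
    · have := h.1; omega
    · have := h.1; omega
    · exact h.2.2
  have hnm : ∀ D ∈ n, D.1 = a → D ∈ m := by
    intro D hD h
    rw [hnC] at hD
    rw [hmC]
    rcases Multiset.mem_add.1 hD with h1 | h1
    · exact Multiset.mem_add.2 (Or.inl h1)
    · exact Multiset.mem_add.2 (Or.inr ((hb D h1).2.1 h))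
  obtain ⟨m1, m2⟩ := tdsIterF_spec a m.card m le_rfl (fun D hD h => h ▸ hm D hD)
  obtain ⟨n1, n2⟩ := tdsIterF_spec a n.card n le_rfl
    (fun D hD h => h ▸ hm D (hnm D hD h))
  change tdsIter a m ≤ m at m1
  change tdsIter a n ≤ n at n1
  change ∀ u K, wsum (rw' a u) (tdsIter a m) ≤ K ↔ _ at m2
  change ∀ u K, wsum (rw' a u) (tdsIter a n) ≤ K ↔ _ at n2
  -- general description
  have key : ∀ (A : Multiset Seg), (∀ D ∈ A, b ≤ D.2) → ∀ u, u ≤ b → ∀ K,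
      (∀ v, u ≤ v → wsum (fw a v) (C + A) ≤ K) ↔
      ((∀ v, u ≤ v → v < b → wsum (fw a v) C ≤ K) ∧
        ∀ v, wsum (fw a v) A ≤ K - wsum (gw a) C) := by
    intro A hA u hu K
    have c1 : ∀ v, b ≤ v → wsum (fw a v) C = wsum (gw a) C := by
      intro v hv
      apply F_eq_G
      · intro D h1 h2
        have := hCb D h1 (Or.inl h2)
        omega
      · intro D h1 h2
        have := hCb D h1 (Or.inr h2)
        omega
    have c2 : ∀ v, v < b → wsum (fw a v) A = 0 := by
      intro v hv
      apply wsum_eq_zero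
      intro D hD
      have := hA D hD
      unfold fw
      split_ifs <;> omega
    have c3 : 0 ≤ wsum (fw a b) A := by
      rw [← c2 (b - 1) (by omega)]
      apply wsum_le
      intro D hD
      have := hA D hD
      unfold fw
      split_ifs <;> omega
    constructor
    · intro h
      refine ⟨?_, ?_⟩
      · intro v h1 h2
        have := h v h1
        rw [wsum_add, c2 v h2] at this
        omega
      · intro v
        by_cases hv : b ≤ v
        · have := h v (by omega)
          rw [wsum_add, c1 v hv] at this
          omega
        · have := h b hu
          rw [wsum_add, c1 b le_rfl] at this
          rw [c2 v (by omega)]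
          omega
    · rintro ⟨h1, h2⟩ v hv
      rw [wsum_add]
      by_cases hv' : b ≤ v
      · have := h2 v
        rw [c1 v hv']
        omega
      · have := h1 v hv (by omega)
        rw [c2 v (by omega)]
        omega
  have kmn : ∀ u, u ≤ b → ∀ K, (∀ v, u ≤ v → wsum (fw a v) m ≤ K) ↔
      (∀ v, u ≤ v → wsum (fw a v) n ≤ K) := by
    intro u hu K
    have e1 := key (mRange m a b) (fun D hD => (hm1 D hD).2) u hu K
    have e2 := key (trunc l (mRange m a b)) (fun D hD => (hb D hD).1) u hu K
    rw [← hmC] at e1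
    rw [← hnC] at e2
    rw [e1, e2, hsup]
  have hR : ∀ u, u ≤ b → wsum (rw' a u) (tdsIter a m) + wsum (gw a) m =
      wsum (rw' a u) (tdsIter a n) + wsum (gw a) n := by
    intro u hu
    have e1 : ∀ K, wsum (rw' a u) (tdsIter a m) + wsum (gw a) m ≤ K ↔
        ∀ v, u ≤ v → wsum (fw a v) m ≤ K := by
      intro K
      rw [← le_sub_iff_add_le, m2]
      simp only [sub_le_sub_iff_right]
    have e2 : ∀ K, wsum (rw' a u) (tdsIter a n) + wsum (gw a) n ≤ K ↔
        ∀ v, u ≤ v → wsum (fw a v) n ≤ K := by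
      intro K
      rw [← le_sub_iff_add_le, n2]
      simp only [sub_le_sub_iff_right]
    apply le_antisymm
    · rw [e1, kmn u hu, ← e2]
    · rw [e2, ← kmn u hu, ← e1]
  ext D
  obtain ⟨p, q⟩ := D
  rw [Multiset.count_filter, Multiset.count_filter]
  split_ifs with hcond
  · obtain ⟨h1, h2⟩ := hcond
    simp only at h1
    subst h1
    by_cases hq : q < b
    · have e1 := hR q hq.le
      have e2 := hR (q + 1) (by omega)
      have e3 := count_eq_R p q (tdsIter p m)
      have e4 := count_eq_R p q (tdsIter p n)
      omega
    · have hnot : (p, q) ∉ m := by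
        intro h
        apply h2
        simp only [mRange, Multiset.mem_filter]
        exact ⟨h, by omega, by omega, by omega⟩
      rw [Multiset.count_eq_zero_of_notMem (fun h => hnot (Multiset.mem_of_le m1 h)),
        Multiset.count_eq_zero_of_notMem
          (fun h => hnot (hnm _ (Multiset.mem_of_le n1 h) rfl))]
  · rfl

end Multiseg
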